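/- arXiv:1604.06688 — 5 statements merged into one kernel-verified Lean document; each statement's English description precedes it below -/
import Mathlib

section
/- Let d ≥ 1 and let f : ℤᵈ → ℕ satisfy f(n·a) = |n|·f(a) for all n ∈ ℤ and a ∈ ℤᵈ, and f(a+b) ≤ f(a) + f(b) for all a, b ∈ ℤᵈ. Then there exists a unique continuous function N : ℝᵈ → ℝ that is convex, satisfies N(t·x) = t·N(x) for all t ≥ 0 and x ∈ ℝᵈ (linearity on rays from the origin), and satisfies N(a) = f(a) for every a ∈ ℤᵈ. Moreover, this N is a seminorm on ℝᵈ. -/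
/-- `N` is a seminorm on `ℝᵈ = Fin d → ℝ`: absolutely homogeneous and subadditive. -/
def IsSeminorm {d : ℕ} (N : (Fin d → ℝ) → ℝ) : Prop :=
  (∀ (c : ℝ) (x : Fin d → ℝ), N (c • x) = |c| * N x) ∧
  ∀ x y : Fin d → ℝ, N (x + y) ≤ N x + N y

section LatticeExtension

variable {d : ℕ}

/-- Every rational vector is an integer vector divided by a positive integer. -/
lemma exists_pos_mul_eq_intCast (q : Fin d → ℚ) :
    ∃ n : ℕ, 0 < n ∧ ∃ a : Fin d → ℤ,
      (n : ℝ) • (fun i => (q i : ℝ)) = fun i => (a i : ℝ) := by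
  refine ⟨∏ i, (q i).den, Finset.prod_pos fun i _ => (q i).den_pos,
    fun i => (q i).num * ∏ j ∈ Finset.univ.erase i, ((q j).den : ℤ), ?_⟩
  ext i
  have hq : ((q i).den : ℝ) * (q i : ℝ) = (q i).num := by
    exact_mod_cast (q i).den_mul_eq_num
  rw [← Finset.mul_prod_erase Finset.univ _ (Finset.mem_univ i)]
  simp only [Pi.smul_apply, smul_eq_mul]
  push_cast
  rw [← hq]
  ring

lemma denseRange_pi_ratCast : DenseRange fun (q : Fin d → ℚ) i => (q i : ℝ) :=
  DenseRange.piMap fun _ => Rat.denseRange_cast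

/-- A closed predicate that holds at all rational points of `ℝᵈ` holds everywhere. -/
lemma forall_of_isClosed_of_rational {p : (Fin d → ℝ) → Prop} (hp : IsClosed {x | p x})
    (h : ∀ (n : ℕ) (a : Fin d → ℤ) (x : Fin d → ℝ), 0 < n →
      (n : ℝ) • x = (fun i => (a i : ℝ)) → p x) (x : Fin d → ℝ) : p x :=
  denseRange_pi_ratCast.induction_on x hp fun q => by
    obtain ⟨n, hn, a, ha⟩ := exists_pos_mul_eq_intCast q
    exact h n a _ hn ha

variable {f : (Fin d → ℤ) → ℕ}

lemma map_le_sum_mul_norm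
    (h_ray : ∀ (n : ℤ) (a : Fin d → ℤ), f (n • a) = n.natAbs * f a)
    (h_sub : ∀ a b : Fin d → ℤ, f (a + b) ≤ f a + f b) (c : Fin d → ℤ) :
    (f c : ℝ) ≤ (∑ i, (f (Pi.single i 1) : ℝ)) * ‖fun i => (c i : ℝ)‖ := by
  have h0 : f 0 = 0 := by simpa using h_ray 0 0
  have hc : f c ≤ ∑ i, (c i).natAbs * f (Pi.single i 1) := by
    calc f c = f (∑ i, c i • Pi.single i 1) := by
          congr 1
          exact pi_eq_sum_univ' c
      _ ≤ ∑ i, f (c i • Pi.single i 1) :=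
          Finset.le_sum_of_subadditive f h0.le h_sub _ _
      _ = _ := by simp only [h_ray]
  calc (f c : ℝ) ≤ ∑ i, ((c i).natAbs : ℝ) * f (Pi.single i 1) := by exact_mod_cast hc
    _ ≤ ∑ i, (f (Pi.single i 1) : ℝ) * ‖fun i => (c i : ℝ)‖ := by
        refine Finset.sum_le_sum fun i _ => ?_
        rw [mul_comm]
        gcongr
        rw [Nat.cast_natAbs, Int.cast_abs]
        exact norm_le_pi_norm (fun i => (c i : ℝ)) i
    _ = _ := (Finset.sum_mul _ _ _).symm

lemma map_sub_le_sum_mul_norm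
    (h_ray : ∀ (n : ℤ) (a : Fin d → ℤ), f (n • a) = n.natAbs * f a)
    (h_sub : ∀ a b : Fin d → ℤ, f (a + b) ≤ f a + f b) (a b : Fin d → ℤ) :
    (f a : ℝ) - f b ≤
      (∑ i, (f (Pi.single i 1) : ℝ)) * ‖fun i => (a i : ℝ) - (b i : ℝ)‖ := by
  have h1 : (f a : ℝ) ≤ f (a - b) + f b := by
    exact_mod_cast (by simpa using h_sub (a - b) b : f a ≤ f (a - b) + f b)
  have h2 := map_le_sum_mul_norm h_ray h_sub (a - b)
  simp only [Pi.sub_apply, Int.cast_sub] at h2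
  linarith

lemma map_natCast_zsmul
    (h_ray : ∀ (n : ℤ) (a : Fin d → ℤ), f (n • a) = n.natAbs * f a)
    (n : ℕ) (a : Fin d → ℤ) : f ((n : ℤ) • a) = n * f a := by
  simpa using h_ray n a

/-- The homogeneous extension of `f` to the rational points of `ℝᵈ`, with arbitrary values
elsewhere. -/
lemma exists_rational_extension
    (h_ray : ∀ (n : ℤ) (a : Fin d → ℤ), f (n • a) = n.natAbs * f a) :
    ∃ g : (Fin d → ℝ) → ℝ, ∀ (n : ℕ) (a : Fin d → ℤ) (x : Fin d → ℝ), 0 < n →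
      (n : ℝ) • x = (fun i => (a i : ℝ)) → n * g x = f a := by
  have key (x : Fin d → ℝ) : ∃ v : ℝ, ∀ (n : ℕ) (a : Fin d → ℤ), 0 < n →
      (n : ℝ) • x = (fun i => (a i : ℝ)) → n * v = f a := by
    by_cases h : ∃ (m : ℕ) (b : Fin d → ℤ), 0 < m ∧ (m : ℝ) • x = fun i => (b i : ℝ)
    · obtain ⟨m, b, hm, hb⟩ := h
      refine ⟨f b / m, fun n a _ ha => ?_⟩
      have hab : (n : ℤ) • b = (m : ℤ) • a := by
        ext i
        have h1 := congrFun ha i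
        have h2 := congrFun hb i
        simp only [Pi.smul_apply, smul_eq_mul] at h1 h2 ⊢
        have : (n : ℝ) * b i = m * a i := by rw [← h1, ← h2]; ring
        exact_mod_cast this
      have hf : (n : ℝ) * f b = m * f a := by
        exact_mod_cast (map_natCast_zsmul h_ray n b).symm.trans
          ((congrArg f hab).trans (map_natCast_zsmul h_ray m a))
      have hm' : (m : ℝ) ≠ 0 := by positivity
      field_simp
      linarith
    · push Not at h
      exact ⟨0, fun n a hn ha => absurd ha (h n a hn)⟩
  choose g hg using key
  exact ⟨g, fun n a x => hg x n a⟩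

lemma exists_continuous_extension
    (h_ray : ∀ (n : ℤ) (a : Fin d → ℤ), f (n • a) = n.natAbs * f a)
    (h_sub : ∀ a b : Fin d → ℤ, f (a + b) ≤ f a + f b) :
    ∃ N : (Fin d → ℝ) → ℝ, Continuous N ∧
      ∀ (n : ℕ) (a : Fin d → ℤ) (x : Fin d → ℝ), 0 < n →
        (n : ℝ) • x = (fun i => (a i : ℝ)) → n * N x = f a := by
  obtain ⟨g, hg⟩ := exists_rational_extension h_ray
  let S : Set (Fin d → ℝ) :=
    {x | ∃ (n : ℕ) (a : Fin d → ℤ), 0 < n ∧ (n : ℝ) • x = fun i => (a i : ℝ)}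
  have hlip : LipschitzOnWith (∑ i, (f (Pi.single i 1) : NNReal)) g S := by
    refine LipschitzOnWith.of_le_add_mul _ ?_
    rintro x ⟨n, a, hn, ha⟩ y ⟨m, b, hm, hb⟩
    have h := map_sub_le_sum_mul_norm h_ray h_sub ((m : ℤ) • a) ((n : ℤ) • b)
    have hxy : (fun i => ((((m : ℤ) • a) i : ℤ) : ℝ) - ((((n : ℤ) • b) i : ℤ) : ℝ)) =
        ((n : ℝ) * m) • (x - y) := by
      ext i
      have h1 := congrFun ha i
      have h2 := congrFun hb i
      simp only [Pi.smul_apply, smul_eq_mul, Pi.sub_apply] at h1 h2 ⊢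
      push_cast
      rw [← h1, ← h2]
      ring
    rw [hxy, norm_smul, map_natCast_zsmul h_ray, map_natCast_zsmul h_ray,
      Real.norm_of_nonneg (by positivity)] at h
    push_cast at h ⊢
    rw [← hg n a x hn ha, ← hg m b y hm hb] at h
    rw [dist_eq_norm]
    have hnm : (0 : ℝ) < n * m := by positivity
    refine le_of_mul_le_mul_left ?_ hnm
    linarith
  obtain ⟨N, hN, hgN⟩ := hlip.extend_real
  exact ⟨N, hN.continuous, fun n a x hn ha => hgN ⟨n, a, hn, ha⟩ ▸ hg n a x hn ha⟩

lemma isSeminorm_of_rational {N : (Fin d → ℝ) → ℝ}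
    (h_ray : ∀ (n : ℤ) (a : Fin d → ℤ), f (n • a) = n.natAbs * f a)
    (h_sub : ∀ a b : Fin d → ℤ, f (a + b) ≤ f a + f b) (hN : Continuous N)
    (h : ∀ (n : ℕ) (a : Fin d → ℤ) (x : Fin d → ℝ), 0 < n →
      (n : ℝ) • x = (fun i => (a i : ℝ)) → n * N x = f a) : IsSeminorm N := by
  constructor
  · intro c
    refine forall_of_isClosed_of_rational (isClosed_eq (by fun_prop) (by fun_prop)) ?_
    intro n a x hn ha
    refine Rat.denseRange_cast.induction_on (p := fun c : ℝ => N (c • x) = |c| * N x) c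
      (isClosed_eq (by fun_prop) (by fun_prop)) fun q => ?_
    have hq : (q.den : ℝ) * (q : ℝ) = q.num := by exact_mod_cast q.den_mul_eq_num
    have hden : (0 : ℝ) < q.den := by exact_mod_cast q.den_pos
    have hqx := h (q.den * n) (q.num • a) ((q : ℝ) • x) (Nat.mul_pos q.den_pos hn) (by
      ext i
      have h1 := congrFun ha i
      simp only [Pi.smul_apply, smul_eq_mul] at h1 ⊢
      push_cast
      rw [← h1, ← hq]
      ring)
    rw [h_ray] at hqx
    push_cast [Nat.cast_natAbs] at hqx
    rw [← h n a x hn ha, ← hq, abs_mul, abs_of_pos hden] at hqx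
    have hpos : (0 : ℝ) < q.den * n := by positivity
    refine mul_left_cancel₀ hpos.ne' ?_
    linarith
  · intro x y
    revert x
    refine forall_of_isClosed_of_rational (isClosed_le (by fun_prop) (by fun_prop)) ?_
    intro n a x hn ha
    revert y
    refine forall_of_isClosed_of_rational (isClosed_le (by fun_prop) (by fun_prop)) ?_
    intro m b y hm hb
    have hxy := h (n * m) ((m : ℤ) • a + (n : ℤ) • b) (x + y) (Nat.mul_pos hn hm) (by
      ext i
      have h1 := congrFun ha i
      have h2 := congrFun hb i
      simp only [Pi.smul_apply, smul_eq_mul, Pi.add_apply] at h1 h2 ⊢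
      push_cast
      rw [← h1, ← h2]
      ring)
    have hle : (f ((m : ℤ) • a + (n : ℤ) • b) : ℝ) ≤ m * f a + n * f b := by
      have := h_sub ((m : ℤ) • a) ((n : ℤ) • b)
      rw [map_natCast_zsmul h_ray, map_natCast_zsmul h_ray] at this
      exact_mod_cast this
    rw [← hxy, ← h n a x hn ha, ← h m b y hm hb] at hle
    push_cast at hle
    have hpos : (0 : ℝ) < n * m := by positivity
    refine le_of_mul_le_mul_left ?_ hpos
    linarith

lemma IsSeminorm.convexOn {N : (Fin d → ℝ) → ℝ} (hN : IsSeminorm N) :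
    ConvexOn ℝ Set.univ N := by
  refine ⟨convex_univ, fun x _ y _ s t hs ht _ => ?_⟩
  have h := hN.2 (s • x) (t • y)
  rwa [hN.1, hN.1, abs_of_nonneg hs, abs_of_nonneg ht] at h

lemma natCast_mul_eq_of_linear_on_rays {N : (Fin d → ℝ) → ℝ}
    (hray : ∀ t : ℝ, 0 ≤ t → ∀ x : Fin d → ℝ, N (t • x) = t * N x)
    (hf : ∀ a : Fin d → ℤ, N (fun i => (a i : ℝ)) = (f a : ℝ))
    (n : ℕ) (a : Fin d → ℤ) (x : Fin d → ℝ) (ha : (n : ℝ) • x = fun i => (a i : ℝ)) :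
    n * N x = f a := by
  rw [← hray n n.cast_nonneg, ha, hf]

end LatticeExtension

/-- an `ℕ`-valued function on `ℤᵈ` that is linear on rays
(`f (n • a) = |n| * f a`) and subadditive extends uniquely to a continuous, convex
function on `ℝᵈ` that is linear on rays from the origin; moreover this extension
is a seminorm. -/
theorem statement_0 (d : ℕ) (hd : 1 ≤ d) (f : (Fin d → ℤ) → ℕ)
    (h_ray : ∀ (n : ℤ) (a : Fin d → ℤ), f (n • a) = n.natAbs * f a)
    (h_sub : ∀ a b : Fin d → ℤ, f (a + b) ≤ f a + f b) :
    (∃! N : (Fin d → ℝ) → ℝ,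
      Continuous N ∧ ConvexOn ℝ Set.univ N ∧
      (∀ t : ℝ, 0 ≤ t → ∀ x : Fin d → ℝ, N (t • x) = t * N x) ∧
      (∀ a : Fin d → ℤ, N (fun i => (a i : ℝ)) = (f a : ℝ))) ∧
    (∀ N : (Fin d → ℝ) → ℝ,
      Continuous N → ConvexOn ℝ Set.univ N →
      (∀ t : ℝ, 0 ≤ t → ∀ x : Fin d → ℝ, N (t • x) = t * N x) →
      (∀ a : Fin d → ℤ, N (fun i => (a i : ℝ)) = (f a : ℝ)) →
      IsSeminorm N) := by
  obtain ⟨N, hN, h⟩ := exists_continuous_extension h_ray h_sub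
  have hs := isSeminorm_of_rational h_ray h_sub hN h
  refine ⟨⟨N, ⟨hN, hs.convexOn, fun t ht x => by rw [hs.1, abs_of_nonneg ht],
    fun a => ?_⟩, ?_⟩, ?_⟩
  · simpa using h 1 a _ one_pos (by simp)
  · rintro M ⟨hM, -, hray, hf⟩
    funext x
    revert x
    refine forall_of_isClosed_of_rational (isClosed_eq hM hN) fun n a x hn ha => ?_
    have hn' : (n : ℝ) ≠ 0 := by positivity
    exact mul_left_cancel₀ hn'
      ((natCast_mul_eq_of_linear_on_rays hray hf n a x ha).trans (h n a x hn ha).symm)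
  · intro M hM _ hray hf
    exact isSeminorm_of_rational h_ray h_sub hM fun n a x _ ha =>
      natCast_mul_eq_of_linear_on_rays hray hf n a x ha
end

section
/- Let d ≥ 1 and let N be a seminorm on ℝᵈ taking integer values on ℤᵈ and satisfying N(a) ≥ 1 for every a ∈ ℤᵈ with a ≠ 0. Then N is a norm, i.e., N(x) > 0 for every x ∈ ℝᵈ with x ≠ 0. -/
namespace IsSeminorm

variable {d : ℕ} {N : (Fin d → ℝ) → ℝ}

theorem map_zero (hN : IsSeminorm N) : N 0 = 0 := by
  simpa using hN.1 0 0

theorem map_neg (hN : IsSeminorm N) (x : Fin d → ℝ) : N (-x) = N x := by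
  simpa using hN.1 (-1) x

theorem nonneg (hN : IsSeminorm N) (x : Fin d → ℝ) : 0 ≤ N x := by
  have h := hN.2 x (-x)
  rw [add_neg_cancel, hN.map_zero, hN.map_neg] at h
  linarith

/-- A seminorm on `ℝᵈ` is dominated by a multiple of the sup norm. -/
theorem le_sum_mul_norm (hN : IsSeminorm N) (x : Fin d → ℝ) :
    N x ≤ (∑ i, N (Pi.single i 1)) * ‖x‖ := by
  have hx : x = ∑ i, x i • (Pi.single i 1 : Fin d → ℝ) := by
    simpa using pi_eq_sum_univ' x
  calc N x = N (∑ i, x i • (Pi.single i 1 : Fin d → ℝ)) := congrArg N hx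
    _ ≤ ∑ i, N (x i • (Pi.single i 1 : Fin d → ℝ)) :=
        Finset.le_sum_of_subadditive N hN.map_zero.le hN.2 _ _
    _ ≤ ∑ i, N (Pi.single i 1) * ‖x‖ := by
        refine Finset.sum_le_sum fun i _ => ?_
        rw [hN.1, mul_comm]
        exact mul_le_mul_of_nonneg_left (norm_le_pi_norm x i) (hN.nonneg _)
    _ = (∑ i, N (Pi.single i 1)) * ‖x‖ := (Finset.sum_mul _ _ _).symm

end IsSeminorm

/-- Simultaneous Diophantine approximation: some positive integer multiple of a real vector is
arbitrarily close to the integer lattice. -/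
theorem exists_pos_nsmul_norm_sub_intCast_lt {ι : Type*} [Fintype ι] (x : ι → ℝ) {ε : ℝ}
    (hε : 0 < ε) :
    ∃ (q : ℕ) (p : ι → ℤ), 0 < q ∧ ‖(q : ℝ) • x - fun i => (p i : ℝ)‖ < ε := by
  let u : ℕ → ι → ℝ := fun n i => Int.fract (n * x i)
  have hu : ∀ n, u n ∈ Set.Icc (0 : ι → ℝ) 1 := fun n =>
    ⟨fun i => Int.fract_nonneg _, fun i => (Int.fract_lt_one _).le⟩
  obtain ⟨a, -, φ, hφ, ha⟩ := isCompact_Icc.tendsto_subseq hu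
  obtain ⟨K, hK⟩ := Metric.cauchySeq_iff'.1 ha.cauchySeq ε hε
  have hlt : φ K < φ (K + 1) := hφ K.lt_succ_self
  refine ⟨φ (K + 1) - φ K, fun i => ⌊φ (K + 1) * x i⌋ - ⌊φ K * x i⌋, Nat.sub_pos_of_lt hlt, ?_⟩
  have h := hK (K + 1) K.le_succ
  rw [dist_eq_norm] at h
  convert h using 1
  congr 1
  ext i
  simp only [Function.comp_apply, u, Pi.sub_apply, Pi.smul_apply, smul_eq_mul, Int.fract,
    Nat.cast_sub hlt.le, Int.cast_sub]
  ring

/-- a seminorm on `ℝᵈ` taking integer values on `ℤᵈ` and at least `1`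
on every nonzero integer point is a norm. -/
theorem statement_1 (d : ℕ) (hd : 1 ≤ d) (N : (Fin d → ℝ) → ℝ)
    (hN : IsSeminorm N)
    (h_int : ∀ a : Fin d → ℤ, ∃ m : ℤ, N (fun i => (a i : ℝ)) = (m : ℝ))
    (h_one : ∀ a : Fin d → ℤ, a ≠ 0 → 1 ≤ N (fun i => (a i : ℝ))) :
    ∀ x : Fin d → ℝ, x ≠ 0 → 0 < N x := by
  intro x hx
  by_contra hpos
  have hx0 : N x = 0 := le_antisymm (not_lt.1 hpos) (hN.nonneg x)
  obtain ⟨i, hi⟩ := Function.ne_iff.1 hx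
  rw [Pi.zero_apply] at hi
  set C := ∑ i, N (Pi.single i 1) with hC
  have hC0 : 0 ≤ C := Finset.sum_nonneg fun i _ => hN.nonneg _
  obtain ⟨q, p, hq, hp⟩ := exists_pos_nsmul_norm_sub_intCast_lt ((x i)⁻¹ • x)
    (show 0 < 1 / (C + 1) by positivity)
  set v : Fin d → ℝ := (q : ℝ) • (x i)⁻¹ • x - fun i => (p i : ℝ) with hv
  rw [lt_div_iff₀ (by positivity)] at hp
  have hv0 := norm_nonneg v
  have hp0 : p ≠ 0 := by
    rintro rfl
    have hvi : v i = q := by simp [hv, hi]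
    have h1 := norm_le_pi_norm v i
    have h2 : (1 : ℝ) ≤ q := by exact_mod_cast hq
    rw [hvi, Real.norm_of_nonneg (by positivity)] at h1
    nlinarith
  have hNp : N (fun i => (p i : ℝ)) ≤ C * ‖v‖ := by
    calc N (fun i => (p i : ℝ)) = N ((q : ℝ) • (x i)⁻¹ • x + -v) := by
          congr 1
          rw [hv]
          abel
      _ ≤ N ((q : ℝ) • (x i)⁻¹ • x) + N (-v) := hN.2 _ _
      _ = N v := by rw [hN.1, hN.1, hx0, hN.map_neg]; ring
      _ ≤ C * ‖v‖ := hN.le_sum_mul_norm v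
  linarith [h_one p hp0]
end

section
/- If N is a seminorm on ℝᵈ that takes integer values on ℤᵈ, then there is a finite nonempty subset F ⊆ ℤᵈ such that N(x) = max_{y ∈ F} ⟨x,y⟩ for all x ∈ ℝᵈ. -/
/-- An integer-valued function on an abelian group that is subadditive and homogeneous for
multiplication by natural numbers. -/
structure IsIntSublinear {G : Type*} [AddCommGroup G] (p : G → ℤ) : Prop where
  add_le : ∀ a b, p (a + b) ≤ p a + p b
  nsmul : ∀ (n : ℕ) a, p (n • a) = n * p a

/-- An antitone sequence of integers that is bounded below is eventually constant. -/
theorem Antitone.exists_eventually_eq_of_le {s : ℕ → ℤ} (hs : Antitone s) {B : ℤ}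
    (hB : ∀ k, B ≤ s k) : ∃ v, ∃ K, ∀ k, K ≤ k → s k = v := by
  obtain ⟨v, ⟨K, rfl⟩, hv⟩ := Int.exists_least_of_bdd (P := fun z => ∃ k, s k = z)
    ⟨B, by rintro z ⟨k, rfl⟩; exact hB k⟩ ⟨s 0, 0, rfl⟩
  exact ⟨s K, K, fun k hk => le_antisymm (hs hk) (hv _ ⟨k, rfl⟩)⟩

namespace IsIntSublinear

variable {G : Type*} [AddCommGroup G] {p : G → ℤ}

theorem map_zero (hp : IsIntSublinear p) : p 0 = 0 := by
  simpa using hp.nsmul 0 0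

theorem neg_le (hp : IsIntSublinear p) (a : G) : -p (-a) ≤ p a := by
  have := hp.add_le a (-a)
  rw [add_neg_cancel, hp.map_zero] at this
  linarith

/-- The one-sided directional derivative of `p` at `a` is again integral and sublinear,
lies below `p`, and is additive along `a`. -/
theorem exists_directional_derivative (hp : IsIntSublinear p) (a : G) :
    ∃ q : G → ℤ, IsIntSublinear q ∧ (∀ b, q b ≤ p b) ∧ q a = p a ∧ q (-a) = -p a := by
  have stab : ∀ b, ∃ v, ∃ K : ℕ, ∀ k : ℕ, K ≤ k → p (k • a + b) - k * p a = v := by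
    intro b
    refine Antitone.exists_eventually_eq_of_le (B := -p (-b)) (antitone_nat_of_succ_le ?_) ?_
    · intro k
      have h := hp.add_le (k • a + b) a
      rw [show k • a + b + a = (k + 1) • a + b by rw [succ_nsmul]; abel] at h
      push_cast
      linarith
    · intro k
      have h := hp.add_le (k • a + b) (-b)
      rw [add_neg_cancel_right, hp.nsmul] at h
      linarith
  choose q K hK using stab
  refine ⟨q, ⟨?_, ?_⟩, ?_, ?_, ?_⟩
  · intro b c
    let k := K b + K c + K (b + c)
    have hb := hK b k (by omega)
    have hc := hK c k (by omega)
    have hbc := hK (b + c) (k + k) (by omega)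
    have h := hp.add_le (k • a + b) (k • a + c)
    rw [show k • a + b + (k • a + c) = (k + k) • a + (b + c) by
      rw [add_add_add_comm, ← add_nsmul]] at h
    push_cast at hbc
    linarith
  · intro n b
    let k := K b + K (n • b)
    have hb := hK b k (by omega)
    rcases Nat.eq_zero_or_pos n with rfl | hn
    · have h := hK (0 • b) (K (0 • b)) le_rfl
      rw [zero_nsmul, add_zero, hp.nsmul, sub_self] at h
      simp [← h]
    · have h := hK (n • b) (n * k)
        ((Nat.le_add_left _ _).trans (Nat.le_mul_of_pos_left k hn))
      rw [mul_nsmul', ← nsmul_add, hp.nsmul] at h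
      push_cast at h
      rw [← h, ← hb]
      ring
  · intro b
    have h := hK b (K b) le_rfl
    have h' := hp.add_le (K b • a) b
    rw [hp.nsmul] at h'
    linarith
  · have h := hK a (K a) le_rfl
    rw [← succ_nsmul, hp.nsmul] at h
    push_cast at h
    linarith
  · have h := hK (-a) (K (-a) + 1) (by omega)
    rw [succ_nsmul, add_neg_cancel_right, hp.nsmul] at h
    push_cast at h
    linarith

/-- If `q ≤ p` and `p` is additive along `a`, then so is `q`, with the same value at `a`. -/
theorem eq_of_le {q : G → ℤ} (hq : IsIntSublinear q) {a : G} (hle : ∀ b, q b ≤ p b)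
    (ha : p (-a) = -p a) : q a = p a ∧ q (-a) = -q a := by
  have h₁ := hq.neg_le a
  have h₂ := hle a
  have h₃ := hle (-a)
  constructor <;> linarith

/-- Below `p` there is an integral sublinear function which is additive along every element of a
given finite set and agrees with `p` at a given point. -/
theorem exists_le_neg_eq (hp : IsIntSublinear p) (a : G) (s : Finset G) :
    ∃ q : G → ℤ, IsIntSublinear q ∧ (∀ b, q b ≤ p b) ∧ q a = p a ∧ ∀ b ∈ s, q (-b) = -q b := by
  classical
  suffices h : ∃ q : G → ℤ, IsIntSublinear q ∧ (∀ b, q b ≤ p b) ∧ q a = p a ∧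
      q (-a) = -q a ∧ ∀ b ∈ s, q (-b) = -q b by
    obtain ⟨q, h₁, h₂, h₃, -, h₄⟩ := h
    exact ⟨q, h₁, h₂, h₃, h₄⟩
  induction s using Finset.induction_on with
  | empty =>
    obtain ⟨q, hq, hle, h₁, h₂⟩ := hp.exists_directional_derivative a
    exact ⟨q, hq, hle, h₁, by rw [h₁, h₂], by simp⟩
  | insert c s _ ih =>
    obtain ⟨q, hq, hle, h₁, h₂, h₃⟩ := ih
    obtain ⟨r, hr, hrle, hc, hc'⟩ := hq.exists_directional_derivative c
    obtain ⟨ha, ha'⟩ := hr.eq_of_le hrle h₂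
    refine ⟨r, hr, fun b => (hrle b).trans (hle b), ha.trans h₁, ha', fun b hb => ?_⟩
    rcases Finset.mem_insert.1 hb with rfl | hb
    · rw [hc, hc']
    · exact (hr.eq_of_le hrle (h₃ b hb)).2

theorem map_add_of_neg_eq (hp : IsIntSublinear p) {a : G} (ha : p (-a) = -p a) (b : G) :
    p (a + b) = p a + p b := by
  refine le_antisymm (hp.add_le a b) ?_
  have h := hp.add_le (-a) (a + b)
  rw [neg_add_cancel_left] at h
  linarith

/-- An integral Hahn–Banach theorem for finitely generated groups: an integral sublinear function
is supported at every point by an additive functional. -/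
theorem exists_addMonoidHom [AddGroup.FG G] (hp : IsIntSublinear p) (a : G) :
    ∃ f : G →+ ℤ, (∀ b, f b ≤ p b) ∧ f a = p a := by
  obtain ⟨s, hs⟩ := AddGroup.fg_def.1 ‹AddGroup.FG G›
  obtain ⟨q, hq, hle, ha, hneg⟩ := hp.exists_le_neg_eq a s
  let H : AddSubgroup G :=
    { carrier := {b | q (-b) = -q b}
      zero_mem' := by simp [hq.map_zero]
      neg_mem' := by
        intro b hb
        simp only [Set.mem_ofPred_eq] at hb ⊢
        rw [neg_neg, hb, neg_neg]
      add_mem' := by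
        intro b c hb hc
        simp only [Set.mem_ofPred_eq] at hb hc ⊢
        rw [hq.map_add_of_neg_eq hb, neg_add,
          hq.map_add_of_neg_eq (a := -b) (by rw [neg_neg, hb, neg_neg]), hb, hc]
        ring }
  have hH : H = ⊤ := top_le_iff.1 (hs ▸ (AddSubgroup.closure_le H).2 hneg)
  have hall : ∀ b, q (-b) = -q b := fun b => by
    have : b ∈ H := hH ▸ AddSubgroup.mem_top b
    exact this
  exact ⟨⟨⟨q, hq.map_zero⟩, fun b c => hq.map_add_of_neg_eq (hall b) c⟩, hle, ha⟩

/-- An integral sublinear function on `ℤᵈ` is the maximum of finitely many integral functionals. -/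
theorem exists_finset_eq_sup' {ι : Type*} [Fintype ι] {p : (ι → ℤ) → ℤ} (hp : IsIntSublinear p) :
    ∃ (F : Finset (ι → ℤ)) (hF : F.Nonempty),
      ∀ a, p a = F.sup' hF (fun y => ∑ i, a i * y i) := by
  classical
  have hfin : {y : ι → ℤ | ∀ a : ι → ℤ, ∑ i, a i * y i ≤ p a}.Finite := by
    refine (Set.finite_Icc (fun i => -p (-Pi.single i 1)) (fun i => p (Pi.single i 1))).subset ?_
    intro y hy
    refine ⟨fun i => ?_, fun i => ?_⟩
    · have := hy (-Pi.single i 1)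
      simp [Pi.single_apply] at this
      linarith
    · simpa [Pi.single_apply] using hy (Pi.single i 1)
  have hex : ∀ a, ∃ y ∈ hfin.toFinset, ∑ i, a i * y i = p a := by
    intro a
    obtain ⟨f, hle, ha⟩ := hp.exists_addMonoidHom a
    have hf : ∀ b : ι → ℤ, ∑ i, b i * f (Pi.single i 1) = f b := by
      intro b
      conv_rhs => rw [← Finset.univ_sum_single b, map_sum]
      refine Finset.sum_congr rfl fun i _ => ?_
      rw [← smul_eq_mul, ← map_zsmul, ← Pi.single_smul, smul_eq_mul, mul_one]
    exact ⟨fun i => f (Pi.single i 1), by simpa [hf] using hle, by rw [hf, ha]⟩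
  obtain ⟨y₀, hy₀, -⟩ := hex 0
  refine ⟨hfin.toFinset, ⟨y₀, hy₀⟩, fun a => le_antisymm ?_ ?_⟩
  · obtain ⟨y, hy, h⟩ := hex a
    rw [← h]
    exact Finset.le_sup' (fun y : ι → ℤ => ∑ i, a i * y i) hy
  · exact Finset.sup'_le _ _ fun y hy => (hfin.mem_toFinset.1 hy) a

end IsIntSublinear

/-- Every rational vector is a quotient of an integral one by a positive integer. -/
theorem exists_common_denominator {ι : Type*} [Fintype ι] (q : ι → ℚ) :
    ∃ (n : ℕ) (a : ι → ℤ), 0 < n ∧ ∀ i, (a i : ℚ) = n * q i := by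
  have h : ∀ i, ∃ z : ℤ, (z : ℚ) = ((∏ j, (q j).den : ℕ) : ℚ) * q i := by
    intro i
    obtain ⟨m, hm⟩ := Finset.dvd_prod_of_mem (fun j => (q j).den) (Finset.mem_univ i)
    refine ⟨m * (q i).num, ?_⟩
    rw [hm]
    push_cast
    rw [mul_comm ((q i).den : ℚ), mul_assoc, Rat.den_mul_eq_num]
  choose a ha using h
  exact ⟨_, a, Finset.prod_pos fun j _ => (q j).den_pos, ha⟩

theorem IsSeminorm.continuous {d : ℕ} {N : (Fin d → ℝ) → ℝ} (hN : IsSeminorm N) :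
    Continuous N := by
  have hconv : ConvexOn ℝ Set.univ N := by
    refine ⟨convex_univ, fun x _ y _ a b ha hb _ => (hN.2 _ _).trans ?_⟩
    rw [hN.1, hN.1, abs_of_nonneg ha, abs_of_nonneg hb, smul_eq_mul, smul_eq_mul]
  exact hconv.locallyLipschitz.continuous

/-- Thurston: a seminorm on `ℝᵈ` taking integer values on `ℤᵈ` is the
maximum of finitely many integral linear functionals `x ↦ ⟨x, y⟩`, `y ∈ F ⊆ ℤᵈ`. -/
theorem statement_2 (d : ℕ) (N : (Fin d → ℝ) → ℝ)
    (hN : IsSeminorm N)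
    (h_int : ∀ a : Fin d → ℤ, ∃ m : ℤ, N (fun i => (a i : ℝ)) = (m : ℝ)) :
    ∃ (F : Finset (Fin d → ℤ)) (hF : F.Nonempty),
      ∀ x : Fin d → ℝ, N x = F.sup' hF (fun y => ∑ i, x i * (y i : ℝ)) := by
  choose p hpN using h_int
  have hp : IsIntSublinear p := by
    refine ⟨fun a b => ?_, fun n a => ?_⟩
    · have h := hN.2 (fun i => (a i : ℝ)) (fun i => (b i : ℝ))
      rw [show ((fun i => (a i : ℝ)) + fun i => (b i : ℝ)) = fun i => (((a + b) i : ℤ) : ℝ) by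
        ext i; simp, hpN, hpN, hpN] at h
      exact_mod_cast h
    · have h := hN.1 n (fun i => (a i : ℝ))
      rw [show ((n : ℝ) • fun i => (a i : ℝ)) = fun i => (((n • a) i : ℤ) : ℝ) by
        ext i; simp, hpN, hpN, Nat.abs_cast] at h
      exact_mod_cast h
  obtain ⟨F, hF, hpF⟩ := hp.exists_finset_eq_sup'
  have hdense : DenseRange (Pi.map fun (_ : Fin d) (q : ℚ) => (q : ℝ)) :=
    DenseRange.piMap fun _ => Rat.denseRange_cast
  have hcont : Continuous fun x : Fin d → ℝ => F.sup' hF fun y => ∑ i, x i * (y i : ℝ) :=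
    Continuous.finset_sup'_apply hF fun y _ => by fun_prop
  refine ⟨F, hF, congrFun (hdense.equalizer hN.continuous hcont (funext fun q => ?_))⟩
  obtain ⟨n, a, hn, ha⟩ := exists_common_denominator q
  have hn' : (0 : ℝ) < n := by exact_mod_cast hn
  have haR : ∀ i, (a i : ℝ) = n * (q i : ℝ) := fun i => by exact_mod_cast ha i
  have hNa : N (fun i => (a i : ℝ)) = n * N (fun i => (q i : ℝ)) := by
    have h := hN.1 n (fun i => (q i : ℝ))
    rw [Nat.abs_cast] at h
    rw [← h]
    congr 1
    ext i
    simp [haR]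
  refine mul_left_cancel₀ hn'.ne' ?_
  change n * N (fun i => (q i : ℝ)) = n * F.sup' hF fun y => ∑ i, (q i : ℝ) * (y i : ℝ)
  rw [← hNa, hpN, hpF, Finset.mul₀_sup' hn'.le,
    Finset.apply_sup'_eq_sup'_comp hF (fun z : ℤ => (z : ℝ)) fun x y => Int.cast_max]
  refine Finset.sup'_congr hF rfl fun y _ => ?_
  simp [haR, Finset.mul_sum, mul_assoc]
end

section
/- Let N be a norm on ℝᵈ taking integer values on ℤᵈ. Then there is a finite subset F ⊆ ℤᵈ such that the unit ball of N satisfies {x ∈ ℝᵈ : N(x) ≤ 1} = {x ∈ ℝᵈ : ⟨x,y⟩ ≤ 1 for all y ∈ F}; that is, the unit ball is a polyhedron with finitely many sides, each given by a linear inequality with integer coefficients. -/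
/-- An integer-valued function on an additive group that is subadditive and
homogeneous for multiplication by natural numbers. -/
def IsIntSublinear_s4 {G : Type*} [AddCommGroup G] (p : G → ℤ) : Prop :=
  (∀ x y, p (x + y) ≤ p x + p y) ∧ ∀ (n : ℕ) (x : G), p (n • x) = n * p x

/-- The directional derivative at `a` of an integer-valued sublinear function is again
integer-valued and sublinear. -/
theorem IsIntSublinear_s4.exists_le_neg {G : Type*} [AddCommGroup G] {p : G → ℤ}
    (hp : IsIntSublinear_s4 p) (a : G) :
    ∃ q : G → ℤ, IsIntSublinear_s4 q ∧ q ≤ p ∧ q (-a) ≤ -p a := by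
  obtain ⟨hadd, hmul⟩ := hp
  have hbdd : ∀ b, BddBelow (Set.range fun n : ℕ => p (n • a + b) - n * p a) := by
    intro b
    refine ⟨-p (-b), ?_⟩
    rintro _ ⟨n, rfl⟩
    have h := hadd (n • a + b) (-b)
    rw [add_neg_cancel_right, hmul] at h
    simp only
    linarith
  set q : G → ℤ := fun b => ⨅ n : ℕ, (p (n • a + b) - n * p a)
  have hle : ∀ b (n : ℕ), q b ≤ p (n • a + b) - n * p a := fun b n => ciInf_le (hbdd b) n
  have hex : ∀ b, ∃ n : ℕ, p (n • a + b) - n * p a = q b := fun b =>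
    Int.csInf_mem (Set.range_nonempty _) (hbdd b)
  have hp0 : p 0 = 0 := by simpa using hmul 0 0
  have hq0 : q 0 = 0 := by
    obtain ⟨n, hn⟩ := hex 0
    rw [← hn, add_zero, hmul, sub_self]
  have hqadd : ∀ x y, q (x + y) ≤ q x + q y := by
    intro x y
    obtain ⟨n, hn⟩ := hex x
    obtain ⟨m, hm⟩ := hex y
    have h1 := hle (x + y) (n + m)
    have h2 := hadd (n • a + x) (m • a + y)
    rw [show (n + m) • a + (x + y) = n • a + x + (m • a + y) by rw [add_nsmul]; abel] at h1
    push_cast at h1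
    linarith
  refine ⟨q, ⟨hqadd, fun k x => le_antisymm ?_ ?_⟩, fun b => by simpa using hle b 0, ?_⟩
  · induction k with
    | zero => simp [hq0]
    | succ k ih =>
      have := hqadd (k • x) x
      rw [succ_nsmul]
      push_cast
      linarith
  · rcases k with _ | k
    · simp [hq0]
    · obtain ⟨n, hn⟩ := hex ((k + 1) • x)
      have h1 := hle x n
      have h2 := hadd ((k * n) • a) (n • a + (k + 1) • x)
      rw [show (k * n) • a + (n • a + (k + 1) • x) = (k + 1) • (n • a + x) by
        rw [nsmul_add, smul_smul, add_mul, one_mul, add_nsmul a (k * n), add_assoc], hmul, hmul] at h2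
      have h3 := mul_le_mul_of_nonneg_left h1 (Int.natCast_nonneg (k + 1))
      push_cast at *
      linarith
  · have := hle (-a) 1
    simpa [hp0] using this

/-- An integer-valued sublinear function on `ℤᵈ` dominates an integral linear form. -/
theorem IsIntSublinear_s4.exists_linear_le {ι : Type*} [Fintype ι] [DecidableEq ι]
    {p : (ι → ℤ) → ℤ} (hp : IsIntSublinear_s4 p) :
    ∃ y : ι → ℤ, ∀ a, ∑ i, a i * y i ≤ p a := by
  have key : ∀ s : Finset ι, ∃ q : (ι → ℤ) → ℤ, IsIntSublinear_s4 q ∧ q ≤ p ∧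
      ∀ i ∈ s, q (Pi.single i 1) + q (-Pi.single i 1) ≤ 0 := by
    intro s
    induction s using Finset.induction_on with
    | empty => exact ⟨p, hp, le_rfl, by simp⟩
    | insert j s _ ih =>
      obtain ⟨q, hq, hqp, hs⟩ := ih
      obtain ⟨r, hr, hrq, hneg⟩ := hq.exists_le_neg (Pi.single j 1)
      refine ⟨r, hr, hrq.trans hqp, fun i hi => ?_⟩
      have h1 := hrq (Pi.single i 1)
      have h2 := hrq (-Pi.single i 1)
      rcases Finset.mem_insert.1 hi with rfl | hi
      · linarith
      · linarith [hs i hi]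
  obtain ⟨q, ⟨hadd, hmul⟩, hqp, hs⟩ := key Finset.univ
  have hq0 : q 0 = 0 := by simpa using hmul 0 0
  refine ⟨fun i => q (Pi.single i 1), fun a => le_trans ?_ (hqp a)⟩
  have hcoord : ∀ i, q (-Pi.single i (a i)) ≤ -(a i * q (Pi.single i 1)) := by
    intro i
    obtain ⟨n, hn | hn⟩ := Int.eq_nat_or_neg (a i)
    · have h : (-Pi.single i (a i) : ι → ℤ) = n • (-Pi.single i 1) := by
        rw [smul_neg, ← Pi.single_smul', hn]; simp
      rw [h, hmul, hn, ← mul_neg]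
      exact mul_le_mul_of_nonneg_left (by linarith [hs i (Finset.mem_univ i)]) (by positivity)
    · have h : (-Pi.single i (a i) : ι → ℤ) = n • (Pi.single i 1) := by
        rw [← Pi.single_smul', hn, ← Pi.single_neg]; simp
      rw [h, hmul, hn]
      simp
  have hsum : q (∑ i, -Pi.single i (a i)) ≤ ∑ i, q (-Pi.single i (a i)) :=
    Finset.le_sum_of_subadditive q hq0.le hadd _ _
  rw [Finset.sum_neg_distrib, Finset.univ_sum_single] at hsum
  have h0 := hadd a (-a)
  rw [add_neg_cancel, hq0] at h0
  have := hsum.trans (Finset.sum_le_sum fun i _ => hcoord i)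
  rw [Finset.sum_neg_distrib] at this
  linarith

/-- An integer-valued sublinear function on `ℤᵈ` has an integral supporting form at each point. -/
theorem IsIntSublinear_s4.exists_supporting {ι : Type*} [Fintype ι] [DecidableEq ι]
    {p : (ι → ℤ) → ℤ} (hp : IsIntSublinear_s4 p) (a : ι → ℤ) :
    ∃ y : ι → ℤ, (∀ b, ∑ i, b i * y i ≤ p b) ∧ p a ≤ ∑ i, a i * y i := by
  obtain ⟨q, hq, hqp, ha⟩ := hp.exists_le_neg a
  obtain ⟨y, hy⟩ := hq.exists_linear_le
  refine ⟨y, fun b => (hy b).trans (hqp b), ?_⟩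
  have := (hy (-a)).trans ha
  simp only [Pi.neg_apply, neg_mul, Finset.sum_neg_distrib] at this
  linarith

/-- A closed subset of `ℝᵈ` containing all positive multiples of lattice points is everything. -/
theorem IsClosed.eq_univ_of_smul_int_mem {ι : Type*} {S : Set (ι → ℝ)} (hS : IsClosed S)
    (h : ∀ (n : ℕ) (a : ι → ℤ), (fun i => (a i : ℝ) / (n + 1)) ∈ S) : S = Set.univ := by
  refine Set.eq_univ_of_forall fun x => ?_
  refine hS.mem_of_tendsto (b := Filter.atTop)
    (f := fun n : ℕ => fun i => (⌊x i * (n + 1)⌋ : ℝ) / (n + 1)) ?_ (.of_forall fun n => h n _)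
  refine tendsto_pi_nhds.2 fun i => ?_
  have h1 : Filter.Tendsto (fun n : ℕ => x i - 1 / ((n : ℝ) + 1)) Filter.atTop (nhds (x i)) := by
    simpa using tendsto_const_nhds.sub (tendsto_one_div_add_atTop_nhds_zero_nat (𝕜 := ℝ))
  refine tendsto_of_tendsto_of_tendsto_of_le_of_le h1 tendsto_const_nhds (fun n => ?_) fun n => ?_
  · have hn : (0 : ℝ) < n + 1 := by positivity
    simp only
    rw [le_div_iff₀ hn, sub_mul, one_div_mul_cancel hn.ne']
    exact (Int.sub_one_lt_floor _).le
  · have hn : (0 : ℝ) < n + 1 := by positivity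
    simp only
    rw [div_le_iff₀ hn]
    exact Int.floor_le _

/-- the unit ball of a norm taking integer values on `ℤᵈ` is a polyhedron
cut out by finitely many linear inequalities `⟨x,y⟩ ≤ 1` with integer coefficients `y ∈ F ⊆ ℤᵈ`. -/
theorem statement_4 (d : ℕ) (N : (Fin d → ℝ) → ℝ)
    (hN : IsSeminorm N)
    (h_norm : ∀ x : Fin d → ℝ, x ≠ 0 → 0 < N x)
    (h_int : ∀ a : Fin d → ℤ, ∃ m : ℤ, N (fun i => (a i : ℝ)) = (m : ℝ)) :
    ∃ F : Finset (Fin d → ℤ),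
      {x : Fin d → ℝ | N x ≤ 1} =
        {x : Fin d → ℝ | ∀ y ∈ F, ∑ i, x i * (y i : ℝ) ≤ 1} := by
  choose p hpN using h_int
  have hp : IsIntSublinear_s4 p := by
    refine ⟨fun x y => ?_, fun n x => ?_⟩
    · have h := hN.2 (fun i => (x i : ℝ)) fun i => (y i : ℝ)
      rw [hpN, hpN, show ((fun i => (x i : ℝ)) + fun i => (y i : ℝ)) =
        fun i => (((x + y) i : ℤ) : ℝ) by ext; simp, hpN] at h
      exact_mod_cast h
    · have h := hN.1 (n : ℝ) (fun i => (x i : ℝ))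
      rw [hpN, show ((n : ℝ) • fun i => (x i : ℝ)) =
        fun i => (((n • x) i : ℤ) : ℝ) by ext; simp, hpN, Nat.abs_cast] at h
      exact_mod_cast h
  have hscale : ∀ (n : ℕ) (a : Fin d → ℤ),
      N (fun i => (a i : ℝ) / (n + 1)) = (p a : ℝ) / (n + 1) := by
    intro n a
    have h := hN.1 ((n + 1 : ℝ)⁻¹) (fun i => (a i : ℝ))
    rw [hpN, abs_of_nonneg (by positivity)] at h
    rw [div_eq_inv_mul, ← h]
    congr 1
    ext i
    simp [div_eq_inv_mul]
  have hsum : ∀ (n : ℕ) (a y : Fin d → ℤ),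
      ∑ i, (a i : ℝ) / (n + 1) * (y i : ℝ) = ((∑ i, a i * y i : ℤ) : ℝ) / (n + 1) := by
    intro n a y
    push_cast
    rw [Finset.sum_div]
    exact Finset.sum_congr rfl fun i _ => by ring
  have hfin : {y : Fin d → ℤ | ∀ b, ∑ i, b i * y i ≤ p b}.Finite := by
    refine (Set.finite_Icc (fun i => -p (-Pi.single i 1)) fun i => p (Pi.single i 1)).subset ?_
    intro y hy
    refine ⟨fun i => ?_, fun i => ?_⟩
    · have := hy (-Pi.single i 1)
      simp [Pi.single_apply] at this
      linarith
    · simpa [Pi.single_apply] using hy (Pi.single i 1)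
  have hcont := hN.continuous
  have hle : ∀ y ∈ hfin.toFinset, ∀ x : Fin d → ℝ, ∑ i, x i * (y i : ℝ) ≤ N x := by
    intro y hy
    refine Set.eq_univ_iff_forall.1 (IsClosed.eq_univ_of_smul_int_mem
      (isClosed_le (by fun_prop) hcont) fun n a => ?_)
    change ∑ i, (a i : ℝ) / (n + 1) * (y i : ℝ) ≤ N fun i => (a i : ℝ) / (n + 1)
    rw [hscale, hsum]
    gcongr
    exact (hfin.mem_toFinset.1 hy) a
  have hge : ∀ x : Fin d → ℝ, x ∈ ⋃ y ∈ hfin.toFinset, {x | N x ≤ ∑ i, x i * (y i : ℝ)} := by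
    refine Set.eq_univ_iff_forall.1 (IsClosed.eq_univ_of_smul_int_mem
      (isClosed_biUnion_finset fun y _ => isClosed_le hcont (by fun_prop)) fun n a => ?_)
    obtain ⟨y, hy, hya⟩ := hp.exists_supporting a
    refine Set.mem_biUnion (hfin.mem_toFinset.2 hy) ?_
    rw [Set.mem_ofPred_eq, hscale, hsum]
    gcongr
  refine ⟨hfin.toFinset, Set.Subset.antisymm (fun x hx y hy => (hle y hy x).trans hx) ?_⟩
  intro x hx
  obtain ⟨y, hy, hxy⟩ := Set.mem_iUnion₂.1 (hge x)
  exact le_trans hxy (hx y hy)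
end

section
/- Let X be a set, d : X × X → ℕ an ℕ-valued pseudometric, G a group acting on X by d-isometries, n : G → ℤ a group homomorphism, D ⊆ X a nonempty G-invariant subset, and f : D → ℤ a pre-eikonal function that is n-equivariant, i.e., f(g·y) = f(y) + n(g) for all g ∈ G and y ∈ D. Then the greatest pre-eikonal extension f̄ : X → ℤ, defined by f̄(x) = min_{y ∈ D} (f(y) + d(x,y)) (the minimum exists), is also n-equivariant: f̄(g·x) = f̄(x) + n(g) for all g ∈ G and x ∈ X. -/
/-- if a group `G` acts on `(X, d)` by isometries of an `ℕ`-valued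
pseudometric, `n : G → ℤ` is a homomorphism, `D` is a nonempty `G`-invariant subset,
and `f` is pre-eikonal and `n`-equivariant on `D`, then the greatest pre-eikonal
extension `f̄ x = min_{y ∈ D} (f y + d x y)` (the minimum exists) is `n`-equivariant. -/
theorem statement_11 {X G : Type*} [Group G] (d : X → X → ℕ)
    (h_refl : ∀ x, d x x = 0)
    (h_symm : ∀ x y, d x y = d y x)
    (h_tri : ∀ x y z, d x z ≤ d x y + d y z)
    (act : G → X → X)
    (h_one : ∀ x, act 1 x = x)
    (h_mul : ∀ (g h : G) (x : X), act (g * h) x = act g (act h x))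
    (h_iso : ∀ (g : G) (x y : X), d (act g x) (act g y) = d x y)
    (n : G → ℤ)
    (h_hom : ∀ g h : G, n (g * h) = n g + n h)
    (D : Set X) (hD : D.Nonempty)
    (hD_inv : ∀ g : G, ∀ y ∈ D, act g y ∈ D)
    (f : X → ℤ)
    (h_pre : ∀ y ∈ D, ∀ y' ∈ D,
      |f y' - f y| ≤ (d y y' : ℤ) ∧ f y' - f y ≡ (d y y' : ℤ) [ZMOD 2])
    (h_equi : ∀ g : G, ∀ y ∈ D, f (act g y) = f y + n g) :
    (∀ x : X, ∃ m : ℤ, IsLeast {v : ℤ | ∃ y ∈ D, v = f y + (d x y : ℤ)} m) ∧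
    (∀ fbar : X → ℤ,
      (∀ x : X, IsLeast {v : ℤ | ∃ y ∈ D, v = f y + (d x y : ℤ)} (fbar x)) →
      ∀ (g : G) (x : X), fbar (act g x) = fbar x + n g) := by
  constructor
  · intro x
    obtain ⟨y₀, hy₀⟩ := hD
    obtain ⟨m, hm, hle⟩ := Int.exists_least_of_bdd
      (P := fun v => ∃ y ∈ D, v = f y + (d x y : ℤ))
      ⟨f y₀ - d x y₀, by
        rintro _ ⟨y, hy, rfl⟩
        have hf := (abs_le.mp (h_pre y₀ hy₀ y hy).1).1
        have ht := h_tri y₀ x y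
        rw [h_symm y₀ x] at ht
        lia⟩
      ⟨_, y₀, hy₀, rfl⟩
    exact ⟨m, hm, hle⟩
  · intro fbar hfbar
    have hle : ∀ (g : G) (x : X), fbar (act g x) ≤ fbar x + n g := by
      intro g x
      obtain ⟨y, hy, hxy⟩ := (hfbar x).1
      have h := (hfbar (act g x)).2 ⟨act g y, hD_inv g y hy, rfl⟩
      rw [h_equi g y hy, h_iso] at h
      linarith
    intro g x
    have h_n_one : n 1 = 0 := by simpa using h_hom 1 1
    have h_n_inv : n g⁻¹ + n g = 0 := by rw [← h_hom, inv_mul_cancel, h_n_one]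
    have hge := hle g⁻¹ (act g x)
    rw [← h_mul, inv_mul_cancel, h_one] at hge
    linarith [hle g x]
end
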